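/- arXiv:2005.06019 — 2 statements merged into one kernel-verified Lean document; each statement's English description precedes it below -/
import Mathlib

section
/- Let 𝒮 and ℰ be categories with finite limits and let F : 𝒮 ⥤ ℰ be a functor preserving finite limits. Then the following are equivalent: (i) every object A of ℰ is a subquotient of F I for some object I of 𝒮, i.e. there exist an object C of ℰ, a monomorphism m : C ⟶ F I and an epimorphism e : C ⟶ A; (ii) every morphism a : A ⟶ F I in ℰ fits into a commuting square: there exist an object J of 𝒮, a morphism u : J ⟶ I in 𝒮, an object C of ℰ, an epimorphism e : C ⟶ A and a monomorphism m : C ⟶ F J with F u ≫ ... , precisely m ≫ F u = e ≫ a. -/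
open CategoryTheory CategoryTheory.Limits

/-- For a finite-limit preserving functor `F : 𝒮 ⥤ ℰ` between categories with
finite limits, the following are equivalent:
(i) every object `A` of `ℰ` is a subquotient of `F I` for some `I`;
(ii) every morphism `a : A ⟶ F I` fits into a commuting square `m ≫ F u = e ≫ a`
with `e` epic and `m` monic. -/
theorem tripos_subquotient_iff_cover_over_FI
    {𝒮 : Type u₁} {ℰ : Type u₂} [Category.{v₁} 𝒮] [Category.{v₂} ℰ]
    [HasFiniteLimits 𝒮] [HasFiniteLimits ℰ]
    (F : 𝒮 ⥤ ℰ) [PreservesFiniteLimits F] :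
    (∀ A : ℰ, ∃ (I : 𝒮) (C : ℰ) (m : C ⟶ F.obj I) (e : C ⟶ A), Mono m ∧ Epi e) ↔
    (∀ (I : 𝒮) (A : ℰ) (a : A ⟶ F.obj I),
      ∃ (J : 𝒮) (u : J ⟶ I) (C : ℰ) (e : C ⟶ A) (m : C ⟶ F.obj J),
        Epi e ∧ Mono m ∧ m ≫ F.map u = e ≫ a) := by
  constructor
  · intro h I A a
    obtain ⟨J, C, m, e, hm, he⟩ := h A
    let k : C ⟶ F.obj (J ⨯ I) :=
      prod.lift m (e ≫ a) ≫ inv (prodComparison F J I)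
    have h1 : k ≫ F.map prod.fst = m := by
      simp only [k, Category.assoc, inv_prodComparison_map_fst, prod.lift_fst]
    have h2 : k ≫ F.map prod.snd = e ≫ a := by
      simp only [k, Category.assoc, inv_prodComparison_map_snd, prod.lift_snd]
    have hk : Mono (k ≫ F.map prod.fst) := by rw [h1]; exact hm
    exact ⟨J ⨯ I, prod.snd, C, e, k, he, mono_of_mono k (F.map prod.fst), h2⟩
  · intro h A
    have ht : IsTerminal (F.obj (⊤_ 𝒮)) := terminalIsTerminal.isTerminalObj F _
    obtain ⟨J, _, C, e, m, he, hm, _⟩ := h (⊤_ 𝒮) A (ht.from A)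
    exact ⟨J, C, m, e, hm, he⟩
end

section
/- For every natural number n ≥ 2 there is no generic family for the tripos Fₙ : X ↦ (Fin n → X) over Type: there exist no type Σ and no subset T : Set (Fin n → Σ) such that for every type I and every subset P : Set (Fin n → I) there is a function p : I → Σ with P = {f : Fin n → I | p ∘ f ∈ T}. (Hence Fₙ is not a traditional tripos for n ≥ 2.) -/
/-- For `n ≥ 2` the tripos `Fₙ : X ↦ (Fin n → X)` admits no generic family:
there are no type `S` and subset `T : Set (Fin n → S)` such that every subset
`P : Set (Fin n → I)` of any `Fₙ I` is the preimage of `T` under postcomposition with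
some `p : I → S`. Hence `Fₙ` is not a traditional tripos for `n ≥ 2`. -/
theorem Fn_no_generic_family (n : ℕ) (hn : 2 ≤ n) :
    ¬ ∃ (S : Type) (T : Set (Fin n → S)),
        ∀ (I : Type) (P : Set (Fin n → I)),
          ∃ p : I → S, P = {f : Fin n → I | p ∘ f ∈ T} := by
  classical
  rintro ⟨S, T, h⟩
  obtain ⟨p, hp⟩ := h (Set S) {f | ∀ i j, f i = f j}
  refine Function.cantor_injective p ?_
  intro a b hab
  have h1 : (fun _ : Fin n => a) ∈ {f : Fin n → Set S | ∀ i j, f i = f j} := fun _ _ => rfl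
  have h2 : (fun i : Fin n => if i.val = 0 then a else b) ∈
      {f : Fin n → Set S | ∀ i j, f i = f j} := by
    rw [hp] at h1 ⊢
    have e : p ∘ (fun i : Fin n => if i.val = 0 then a else b) = p ∘ (fun _ : Fin n => a) := by
      funext i
      by_cases hi : i.val = 0 <;> simp [hi, hab]
    rw [Set.mem_setOf_eq, e]
    exact h1
  have h3 := h2 ⟨0, by omega⟩ ⟨1, by omega⟩
  simpa using h3
end
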